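/- For every integer j ≥ 0, setting g_l(z) = Π_{i=1}^{l} (z + q^{2i−1} − q) ∈ K[z], the following identity holds in K[z]: [j]! · Σ_{r=0}^{j} q^{−r²} · ([j choose r])² · g_{j−r}(z) = Σ_{i=0}^{j} ([j]! [2j−i]! / ([i]! ([j−i]!)²)) · (z − q)^i. -/

import Mathlib

open Polynomial Finset

/-- Symmetric q-integer `[n] = (qⁿ − q⁻ⁿ)/(q − q⁻¹)` for `n : ℤ`. -/
noncomputable def qint {K : Type*} [Field K] (q : K) (n : ℤ) : K :=
  (q ^ n - q ^ (-n)) / (q - q⁻¹)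

/-- q-factorial `[n]! = [1][2]⋯[n]`. -/
noncomputable def qfact {K : Type*} [Field K] (q : K) : ℕ → K
  | 0 => 1
  | n + 1 => qfact q n * qint q ((n : ℤ) + 1)

/-- q-binomial coefficient `[n choose k] = [n]!/([k]![n−k]!)` for `0 ≤ k ≤ n`. -/
noncomputable def qbinomN {K : Type*} [Field K] (q : K) (n k : ℕ) : K :=
  qfact q n / (qfact q k * qfact q (n - k))

/-- The polynomial `g_l(z) = Π_{i=1}^{l} (z + q^{2i−1} − q)`. -/
noncomputable def gpoly {K : Type*} [Field K] (q : K) (l : ℕ) : Polynomial K :=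
  ∏ i ∈ Finset.Icc 1 l, (Polynomial.X + Polynomial.C (q ^ (2 * i - 1) - q))

/-- The `q`-binomial coefficient defined by its Pascal recursion; it vanishes for `n < k`. -/
noncomputable def qpascal {K : Type*} [Field K] (q : K) : ℕ → ℕ → K
  | _, 0 => 1
  | 0, _ + 1 => 0
  | n + 1, k + 1 =>
    q ^ (-((k : ℤ) + 1)) * qpascal q n (k + 1) + q ^ ((n : ℤ) - k) * qpascal q n k

section

variable {K : Type*} [Field K] {q : K}

@[simp]
theorem qpascal_zero_right (q : K) (n : ℕ) : qpascal q n 0 = 1 := by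
  cases n <;> rfl

theorem qpascal_succ_succ (q : K) (n k : ℕ) :
    qpascal q (n + 1) (k + 1) =
      q ^ (-((k : ℤ) + 1)) * qpascal q n (k + 1) + q ^ ((n : ℤ) - k) * qpascal q n k :=
  rfl

theorem qpascal_eq_zero_of_lt (q : K) {n k : ℕ} (h : n < k) : qpascal q n k = 0 := by
  induction n generalizing k with
  | zero =>
    obtain ⟨k, rfl⟩ := Nat.exists_eq_add_of_lt h
    rfl
  | succ n ih =>
    obtain ⟨k, rfl⟩ : ∃ l, k = l + 1 := ⟨k - 1, by omega⟩
    rw [qpascal_succ_succ, ih (by omega), ih (by omega)]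
    simp

theorem qint_add (hq0 : q ≠ 0) (a b : ℤ) :
    qint q (a + b) = q ^ (-b) * qint q a + q ^ a * qint q b := by
  simp only [qint, neg_add, zpow_add₀ hq0]
  ring

theorem qint_inv (q : K) (n : ℤ) : qint q⁻¹ n = qint q n := by
  simp only [qint, inv_zpow', neg_neg, inv_inv]
  rw [← neg_sub, ← neg_sub q, neg_div_neg_eq]

theorem qfact_inv (q : K) (n : ℕ) : qfact q⁻¹ n = qfact q n := by
  induction n with
  | zero => rfl
  | succ n ih => rw [qfact, qfact, ih, qint_inv]

theorem qint_ne_zero (hq : ∀ n : ℕ, 1 ≤ n → q ^ (n : ℤ) ≠ q ^ (-(n : ℤ))) {n : ℕ}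
    (hn : 1 ≤ n) : qint q n ≠ 0 :=
  div_ne_zero (sub_ne_zero.2 (hq n hn)) (sub_ne_zero.2 (by simpa using hq 1 le_rfl))

theorem qfact_ne_zero (hq : ∀ n : ℕ, 1 ≤ n → q ^ (n : ℤ) ≠ q ^ (-(n : ℤ))) (n : ℕ) :
    qfact q n ≠ 0 := by
  induction n with
  | zero => exact one_ne_zero
  | succ n ih =>
    have h := qint_ne_zero hq (Nat.le_add_left 1 n)
    push_cast at h
    exact mul_ne_zero ih h

theorem qpascal_add_mul_qfact (hq0 : q ≠ 0) (a b : ℕ) :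
    qpascal q (a + b) a * (qfact q a * qfact q b) = qfact q (a + b) := by
  induction h : a + b generalizing a b with
  | zero =>
    obtain ⟨rfl, rfl⟩ : a = 0 ∧ b = 0 := by omega
    simp [qfact]
  | succ n ih =>
    obtain _ | a := a
    · obtain rfl : b = n + 1 := by omega
      simp [qfact]
    have h₁ := ih a b (by omega)
    have hn : (n : ℤ) = a + b := by omega
    have h₂ : qpascal q n (a + 1) * (qfact q (a + 1) * qfact q b) = qfact q n * qint q b := by
      obtain _ | b := b
      · rw [qpascal_eq_zero_of_lt q (by omega)]
        simp [qint]
      · have := ih (a + 1) b (by omega)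
        rw [← this, qfact.eq_2 q b]
        push_cast
        ring
    have h₃ : qint q ((n : ℤ) + 1) =
        q ^ (-((a : ℤ) + 1)) * qint q b + q ^ (b : ℤ) * qint q ((a : ℤ) + 1) := by
      rw [← qint_add hq0, hn]
      ring_nf
    rw [qpascal_succ_succ, qfact.eq_2 q n, h₃, show (n : ℤ) - a = b by omega, add_mul,
      mul_assoc, h₂, ← h₁, qfact.eq_2 q a]
    ring

theorem qpascal_add (hq0 : q ≠ 0) (hq : ∀ n : ℕ, 1 ≤ n → q ^ (n : ℤ) ≠ q ^ (-(n : ℤ)))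
    (a b : ℕ) : qpascal q (a + b) a = qfact q (a + b) / (qfact q a * qfact q b) :=
  eq_div_of_mul_eq (mul_ne_zero (qfact_ne_zero hq a) (qfact_ne_zero hq b))
    (qpascal_add_mul_qfact hq0 a b)

theorem qpascal_inv (hq0 : q ≠ 0) (hq : ∀ n : ℕ, 1 ≤ n → q ^ (n : ℤ) ≠ q ^ (-(n : ℤ)))
    (n k : ℕ) : qpascal q⁻¹ n k = qpascal q n k := by
  obtain h | h := lt_or_ge n k
  · rw [qpascal_eq_zero_of_lt _ h, qpascal_eq_zero_of_lt _ h]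
  · obtain ⟨b, rfl⟩ := Nat.exists_eq_add_of_le h
    have h' := qpascal_add_mul_qfact (inv_ne_zero hq0) k b
    simp only [qfact_inv] at h'
    rw [qpascal_add hq0 hq]
    exact eq_div_of_mul_eq (mul_ne_zero (qfact_ne_zero hq k) (qfact_ne_zero hq b)) h'

theorem qpascal_succ_succ' (hq0 : q ≠ 0)
    (hq : ∀ n : ℕ, 1 ≤ n → q ^ (n : ℤ) ≠ q ^ (-(n : ℤ))) (n k : ℕ) :
    qpascal q (n + 1) (k + 1) =
      q ^ ((k : ℤ) + 1) * qpascal q n (k + 1) + q ^ ((k : ℤ) - n) * qpascal q n k := by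
  have h := qpascal_succ_succ q⁻¹ n k
  simpa only [qpascal_inv hq0 hq, inv_zpow', neg_neg, neg_sub] using h

/-- The `q`-Vandermonde identity. -/
theorem sum_antidiagonal_qpascal (hq0 : q ≠ 0) (m n k : ℕ) :
    ∑ p ∈ antidiagonal k,
        q ^ ((n : ℤ) * p.1 - m * p.2) * (qpascal q m p.1 * qpascal q n p.2) =
      qpascal q (m + n) k := by
  induction m generalizing k with
  | zero =>
    rw [Finset.sum_eq_single (0, k)]
    · simp
    · rintro ⟨a, b⟩ hp hne
      rw [HasAntidiagonal.mem_antidiagonal] at hp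
      have ha : 0 < a := by
        rcases Nat.eq_zero_or_pos a with rfl | ha
        · simp_all
        · exact ha
      simp [qpascal_eq_zero_of_lt q ha]
    · simp
  | succ m ih =>
    obtain _ | k := k
    · simp
    rw [show m + 1 + n = m + n + 1 by ring, qpascal_succ_succ, ← ih, ← ih,
      Finset.Nat.sum_antidiagonal_succ, Finset.Nat.sum_antidiagonal_succ, mul_add, add_assoc,
      Finset.mul_sum, Finset.mul_sum, ← Finset.sum_add_distrib]
    congr 1
    · simp only [qpascal_zero_right, ← mul_assoc, ← zpow_add₀ hq0]
      congr 3
      push_cast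
      ring
    · refine Finset.sum_congr rfl ?_
      rintro ⟨a, b⟩ hp
      rw [HasAntidiagonal.mem_antidiagonal] at hp
      have hk : (k : ℤ) = a + b := by omega
      simp only [qpascal_succ_succ, hk, add_mul, mul_add, ← mul_assoc, ← zpow_add₀ hq0]
      congr 4 <;> push_cast <;> ring

theorem sum_range_qpascal_mul_qpascal (hq0 : q ≠ 0)
    (hq : ∀ n : ℕ, 1 ≤ n → q ^ (n : ℤ) ≠ q ^ (-(n : ℤ))) (m n : ℕ) :
    ∑ r ∈ range (m + 1),
        q ^ ((m : ℤ) * n - r * (m + n)) * (qpascal q m r * qpascal q n r) =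
      qpascal q (m + n) m := by
  rw [← sum_antidiagonal_qpascal hq0, ← Finset.Nat.sum_antidiagonal_swap,
    Finset.Nat.sum_antidiagonal_eq_sum_range_succ_mk]
  refine Finset.sum_congr rfl fun r hr => ?_
  obtain ⟨s, rfl⟩ := Nat.exists_eq_add_of_le (Nat.lt_succ_iff.1 (mem_range.1 hr))
  have h : qpascal q (r + s) s = qpascal q (r + s) r := by
    rw [qpascal_add hq0 hq, add_comm r s, qpascal_add hq0 hq, mul_comm]
  simp only [Prod.swap, add_tsub_cancel_left, h]
  congr 2
  push_cast
  ring

/-- The `q`-binomial theorem for `gpoly`, in powers of `X - q`. -/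
theorem gpoly_eq_sum (hq0 : q ≠ 0) (hq : ∀ n : ℕ, 1 ≤ n → q ^ (n : ℤ) ≠ q ^ (-(n : ℤ)))
    (l : ℕ) :
    gpoly q l = ∑ i ∈ range (l + 1),
      C (q ^ ((l : ℤ) * (l - i)) * qpascal q l i) * (X - C q) ^ i := by
  induction l with
  | zero => simp [gpoly]
  | succ l ih =>
    have hstep : gpoly q (l + 1) = gpoly q l * ((X - C q) + C (q ^ (2 * (l : ℤ) + 1))) := by
      rw [gpoly, Finset.prod_Icc_succ_top (by omega), gpoly,
        show 2 * (l + 1) - 1 = 2 * l + 1 by omega, map_sub,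
        show (2 * (l : ℤ) + 1) = ((2 * l + 1 : ℕ) : ℤ) by push_cast; ring, zpow_natCast]
      ring
    have hext : gpoly q l = ∑ i ∈ range (l + 1 + 1),
        C (q ^ ((l : ℤ) * (l - i)) * qpascal q l i) * (X - C q) ^ i := by
      rw [Finset.sum_range_succ, qpascal_eq_zero_of_lt q (Nat.lt_succ_self l), ih]
      simp
    rw [Finset.sum_range_succ'] at hext
    rw [hstep, mul_add]
    nth_rewrite 1 [ih]
    rw [hext, Finset.sum_range_succ' _ (l + 1), add_mul, ← add_assoc,
      Finset.sum_mul, Finset.sum_mul, ← Finset.sum_add_distrib]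
    congr 1
    · refine Finset.sum_congr rfl fun i _ => ?_
      have hc : q ^ (((l + 1 : ℕ) : ℤ) * ((l + 1 : ℕ) - (i + 1 : ℕ))) *
            qpascal q (l + 1) (i + 1) =
          q ^ ((l : ℤ) * (l - i)) * qpascal q l i +
            q ^ ((l : ℤ) * (l - (i + 1 : ℕ))) * qpascal q l (i + 1) *
              q ^ (2 * (l : ℤ) + 1) := by
        rw [qpascal_succ_succ' hq0 hq, mul_add, mul_right_comm _ _ (q ^ (2 * (l : ℤ) + 1)),
          add_comm]
        simp only [← mul_assoc, ← zpow_add₀ hq0]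
        congr 3 <;> push_cast <;> ring
      rw [hc, map_add, map_mul C _ (q ^ (2 * (l : ℤ) + 1))]
      ring
    · simp only [qpascal_zero_right, pow_zero, mul_one, ← map_mul, ← zpow_add₀ hq0]
      congr 2
      push_cast
      ring

theorem gpoly_eq_sum_of_le (hq0 : q ≠ 0)
    (hq : ∀ n : ℕ, 1 ≤ n → q ^ (n : ℤ) ≠ q ^ (-(n : ℤ))) {l N : ℕ} (h : l ≤ N) :
    gpoly q l = ∑ i ∈ range (N + 1),
      C (q ^ ((l : ℤ) * (l - i)) * qpascal q l i) * (X - C q) ^ i := by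
  rw [gpoly_eq_sum hq0 hq]
  refine Finset.sum_subset (range_subset_range.2 (by omega)) fun i _ hi => ?_
  rw [qpascal_eq_zero_of_lt q (by simpa using hi)]
  simp

theorem sum_qbinomN_sq_mul_qpascal (hq0 : q ≠ 0)
    (hq : ∀ n : ℕ, 1 ≤ n → q ^ (n : ℤ) ≠ q ^ (-(n : ℤ))) (i m : ℕ) :
    ∑ r ∈ range (i + m + 1), q ^ (-((r : ℤ) ^ 2)) * qbinomN q (i + m) r ^ 2 *
        (q ^ (((i + m - r : ℕ) : ℤ) * ((i + m - r : ℕ) - i)) * qpascal q (i + m - r) i) =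
      qfact q (2 * (i + m) - i) / (qfact q i * qfact q m ^ 2) := by
  have hf := qfact_ne_zero hq
  have hsub : range (m + 1) ⊆ range (i + m + 1) := range_subset_range.2 (by omega)
  rw [← Finset.sum_subset hsub fun r hr' hr => by
    rw [qpascal_eq_zero_of_lt q (by rw [mem_range] at hr hr'; omega)]
    simp]
  have hV : qfact q (i + m) / (qfact q i * qfact q m) * qpascal q (m + (i + m)) m =
      qfact q (2 * (i + m) - i) / (qfact q i * qfact q m ^ 2) := by
    rw [qpascal_add hq0 hq, show 2 * (i + m) - i = m + (i + m) by omega]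
    field_simp [hf]
  rw [← hV, ← sum_range_qpascal_mul_qpascal hq0 hq, Finset.mul_sum]
  refine Finset.sum_congr rfl fun r hr => ?_
  obtain ⟨s, rfl⟩ := Nat.exists_eq_add_of_le (Nat.lt_succ_iff.1 (mem_range.1 hr))
  have hz : q ^ (-((r : ℤ) ^ 2)) * q ^ (((i + s : ℕ) : ℤ) * ((i + s : ℕ) - i)) =
      q ^ (((r + s : ℕ) : ℤ) * (i + (r + s) : ℕ) - r * ((r + s : ℕ) + (i + (r + s) : ℕ))) := by
    rw [← zpow_add₀ hq0]
    congr 1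
    push_cast
    ring
  rw [← hz, qbinomN, show i + (r + s) - r = i + s by omega, qpascal_add hq0 hq i s,
    qpascal_add hq0 hq r s, show i + (r + s) = r + (i + s) by omega,
    qpascal_add hq0 hq r (i + s)]
  have h₁ := hf i
  have h₂ := hf r
  have h₃ := hf s
  have h₄ := hf (i + s)
  have h₅ := hf (r + s)
  generalize q ^ (-((r : ℤ) ^ 2)) = u
  generalize q ^ (((i + s : ℕ) : ℤ) * ((i + s : ℕ) - i)) = v
  field_simp

end

/-- In `K[z]`:
`[j]! Σ_{r=0}^{j} q^{−r²} ([j choose r])² g_{j−r}(z)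
  = Σ_{i=0}^{j} ([j]![2j−i]!/([i]!([j−i]!)²)) (z − q)^i`. -/
theorem stmt10 {K : Type*} [Field K] [CharZero K] (q : K) (hq0 : q ≠ 0)
    (hq : ∀ n : ℕ, 1 ≤ n → q ^ (n : ℤ) ≠ q ^ (-(n : ℤ))) (j : ℕ) :
    Polynomial.C (qfact q j) *
      ∑ r ∈ Finset.range (j + 1),
        Polynomial.C (q ^ (-((r : ℤ) ^ 2)) * (qbinomN q j r) ^ 2) * gpoly q (j - r) =
    ∑ i ∈ Finset.range (j + 1),
      Polynomial.C (qfact q j * qfact q (2 * j - i) / (qfact q i * (qfact q (j - i)) ^ 2)) *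
        (Polynomial.X - Polynomial.C q) ^ i := by
  have hg : ∀ r ∈ range (j + 1),
      C (q ^ (-((r : ℤ) ^ 2)) * (qbinomN q j r) ^ 2) * gpoly q (j - r) =
        ∑ i ∈ range (j + 1), C (q ^ (-((r : ℤ) ^ 2)) * qbinomN q j r ^ 2 *
          (q ^ (((j - r : ℕ) : ℤ) * ((j - r : ℕ) - i)) * qpascal q (j - r) i)) *
            (X - C q) ^ i := by
    intro r _
    rw [gpoly_eq_sum_of_le hq0 hq (Nat.sub_le j r), Finset.mul_sum]
    refine Finset.sum_congr rfl fun i _ => ?_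
    rw [← mul_assoc, ← map_mul]
  rw [Finset.sum_congr rfl hg, Finset.sum_comm, Finset.mul_sum]
  refine Finset.sum_congr rfl fun i hi => ?_
  obtain ⟨m, rfl⟩ := Nat.exists_eq_add_of_le (Nat.lt_succ_iff.1 (mem_range.1 hi))
  rw [← Finset.sum_mul, ← map_sum, sum_qbinomN_sq_mul_qpascal hq0 hq, ← mul_assoc, ← map_mul,
    add_tsub_cancel_left, mul_div_assoc]
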